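/- arXiv:math/0008041 — 2 statements merged into one kernel-verified Lean document; each statement's English description precedes it below -/
import Mathlib

section
/- Let p ∈ {0,…,n} and assume Z_p^d(n) ≠ 0. Then dim_K Z_i^d(n) ≥ binom(p+1, i+1) for every i = 0,…,p. (Since B_i^d(n) = 0, this says: a finitely generated graded S-module M that is a graded submodule of a graded free module — i.e., a first syzygy module — with β_p^{lin}(M) ≠ 0 satisfies β_i^{lin}(M) ≥ binom(p+1, i+1) for i = 0,…,p, which is Herzog's conjecture in the case k = 1.) -/
open MvPolynomial

noncomputable section

/-- The Koszul differential on families of module elements indexed by finite subsets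
of `Fin n`. -/
def koszulD (n : ℕ) {K : Type*} [Field K] {M : Type*} [AddCommGroup M] [Module K M]
    [Module (MvPolynomial (Fin n) K) M] [IsScalarTower K (MvPolynomial (Fin n) K) M] :
    (Finset (Fin n) → M) →ₗ[K] (Finset (Fin n) → M) where
  toFun m L := ∑ k ∈ Lᶜ, ((-1 : ℤ) ^ (L.filter (fun l => l < k)).card) •
      ((X k : MvPolynomial (Fin n) K) • m (insert k L))
  map_add' a b := by
    funext L
    simp [smul_add, Finset.sum_add_distrib]
  map_smul' c a := by
    funext L
    simp only [Pi.smul_apply, RingHom.id_apply, Finset.smul_sum]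
    refine Finset.sum_congr rfl fun k _ => ?_
    rw [smul_comm (X k : MvPolynomial (Fin n) K) c, smul_comm ((-1 : ℤ) ^ (L.filter (fun l => l < k)).card) c]

/-- The degree-`(i, i+t)` piece of the Koszul complex of `x_1, …, x_j` with values in the
graded module with graded pieces `gr`: families `(m_J)` with `m_J ∈ gr t`, supported on
`i`-element subsets of `{1, …, j}` (i.e. of `{0, …, j-1}` in `Fin n`). -/
def koszulC (n : ℕ) {K : Type*} [Field K] {M : Type*} [AddCommGroup M] [Module K M]
    (gr : ℤ → Submodule K M) (i : ℕ) (t : ℤ) (j : ℕ) :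
    Submodule K (Finset (Fin n) → M) where
  carrier := {m | ∀ J : Finset (Fin n),
    m J ∈ gr t ∧ (¬(J.card = i ∧ ∀ k ∈ J, (k : ℕ) < j) → m J = 0)}
  zero_mem' := fun J => ⟨(gr t).zero_mem, fun _ => rfl⟩
  add_mem' := by
    intro a b ha hb J
    refine ⟨(gr t).add_mem (ha J).1 (hb J).1, fun h => ?_⟩
    simp [Pi.add_apply, (ha J).2 h, (hb J).2 h]
  smul_mem' := by
    intro c a ha J
    exact ⟨(gr t).smul_mem c (ha J).1, fun h => by simp [Pi.smul_apply, (ha J).2 h]⟩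

/-- Cycles: `Z_i^t(j)`. -/
def koszulZ (n : ℕ) {K : Type*} [Field K] {M : Type*} [AddCommGroup M] [Module K M]
    [Module (MvPolynomial (Fin n) K) M] [IsScalarTower K (MvPolynomial (Fin n) K) M]
    (gr : ℤ → Submodule K M) (i : ℕ) (t : ℤ) (j : ℕ) :
    Submodule K (Finset (Fin n) → M) :=
  koszulC n gr i t j ⊓ LinearMap.ker (koszulD n)

/-- Boundaries: `B_i^t(j)`, the image of `C_{i+1}^{t-1}(j)` under the differential. -/
def koszulB (n : ℕ) {K : Type*} [Field K] {M : Type*} [AddCommGroup M] [Module K M]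
    [Module (MvPolynomial (Fin n) K) M] [IsScalarTower K (MvPolynomial (Fin n) K) M]
    (gr : ℤ → Submodule K M) (i : ℕ) (t : ℤ) (j : ℕ) :
    Submodule K (Finset (Fin n) → M) :=
  (koszulC n gr (i + 1) (t - 1) j).map (koszulD n)

/-- The contraction `∂_k`. -/
def koszulContr (n : ℕ) {M : Type*} [AddCommGroup M] (k : Fin n)
    (m : Finset (Fin n) → M) : Finset (Fin n) → M :=
  fun L => if k ∈ L then 0
    else ((-1 : ℤ) ^ (L.filter (fun l => l < k)).card) • m (insert k L)

end

open MvPolynomial in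
/-- The degree-`l` graded piece of the graded free module `F = ⊕_u S·g_u` with
`deg(g_u) = w u`: families `f` with each `f u` homogeneous of degree `l - w u`. -/
noncomputable def gradedFreePiece (n r : ℕ) (K : Type*) [Field K] (w : Fin r → ℤ) (l : ℤ) :
    Submodule K (Fin r → MvPolynomial (Fin n) K) where
  carrier := {f | ∀ (u : Fin r) (e : Fin n →₀ ℕ),
    coeff e (f u) ≠ 0 → (e.sum fun _ a => (a : ℤ)) = l - w u}
  zero_mem' := by intro u e h; simp at h
  add_mem' := by
    intro a b ha hb u e h
    by_cases h1 : coeff e (a u) = 0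
    · exact hb u e (by simpa [Pi.add_apply, coeff_add, h1] using h)
    · exact ha u e h1
  smul_mem' := by
    intro c f hf u e h
    refine hf u e fun h0 => h ?_
    simp [Pi.smul_apply, coeff_smul, h0]

section KoszulContraction

variable {K : Type*} [Field K] {n : ℕ} {M : Type*} [AddCommGroup M]

/-- The Koszul sign `(-1) ^ #{l ∈ L | l < k}`. -/
def koszulSign (k : Fin n) (L : Finset (Fin n)) : ℤ :=
  (-1) ^ (L.filter (fun l => l < k)).card

lemma koszulSign_mul_self (k : Fin n) (L : Finset (Fin n)) :
    koszulSign k L * koszulSign k L = 1 := by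
  simp [koszulSign, ← mul_pow]

lemma koszulSign_insert {j : Fin n} {L : Finset (Fin n)} (hj : j ∉ L) (k : Fin n) :
    koszulSign k (insert j L) = (if j < k then -1 else 1) * koszulSign k L := by
  unfold koszulSign
  rw [Finset.filter_insert]
  split_ifs with h
  · rw [Finset.card_insert_of_notMem (by simp [hj]), pow_succ, mul_comm]
  · rw [one_mul]

lemma koszulContr_of_mem {k : Fin n} {L : Finset (Fin n)} (hk : k ∈ L)
    (m : Finset (Fin n) → M) : koszulContr n k m L = 0 := by
  simp [koszulContr, hk]

lemma koszulContr_of_notMem {k : Fin n} {L : Finset (Fin n)} (hk : k ∉ L)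
    (m : Finset (Fin n) → M) :
    koszulContr n k m L = koszulSign k L • m (insert k L) := by
  simp [koszulContr, hk, koszulSign]

lemma koszulContr_koszulContr_self (k : Fin n) (m : Finset (Fin n) → M) :
    koszulContr n k (koszulContr n k m) = 0 := by
  funext L
  by_cases hk : k ∈ L
  · simp [koszulContr_of_mem hk]
  · simp [koszulContr_of_notMem hk, koszulContr_of_mem (Finset.mem_insert_self k L)]

lemma koszulContr_anticomm (j k : Fin n) (m : Finset (Fin n) → M) :
    koszulContr n j (koszulContr n k m) = -koszulContr n k (koszulContr n j m) := by
  rcases eq_or_ne j k with rfl | hjk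
  · simp [koszulContr_koszulContr_self]
  funext L
  rw [Pi.neg_apply]
  by_cases hj : j ∈ L
  · by_cases hk : k ∈ L
    · simp [koszulContr_of_mem hj, koszulContr_of_mem hk]
    · simp [koszulContr_of_mem hj, koszulContr_of_notMem hk,
        koszulContr_of_mem (Finset.mem_insert_of_mem hj)]
  by_cases hk : k ∈ L
  · simp [koszulContr_of_mem hk, koszulContr_of_notMem hj,
      koszulContr_of_mem (Finset.mem_insert_of_mem hk)]
  have hkj : k ∉ insert j L := by simp [hk, hjk.symm]
  have hjk' : j ∉ insert k L := by simp [hj, hjk]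
  rw [koszulContr_of_notMem hj, koszulContr_of_notMem hkj, koszulContr_of_notMem hk,
    koszulContr_of_notMem hjk', koszulSign_insert hj, koszulSign_insert hk,
    Finset.insert_comm k j, smul_smul, smul_smul, ← neg_smul]
  congr 1
  rcases lt_or_gt_of_ne hjk with h | h
  · rw [if_pos h, if_neg h.not_gt]; ring
  · rw [if_neg h.not_gt, if_pos h]; ring

/-- A contraction sends families supported in cardinality `i + 1` to families supported in
cardinality `i`. -/
lemma koszulContr_eq_zero_of_card_ne {i : ℕ} {m : Finset (Fin n) → M}
    (hm : ∀ J : Finset (Fin n), J.card ≠ i + 1 → m J = 0) (k : Fin n)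
    {L : Finset (Fin n)} (hL : L.card ≠ i) : koszulContr n k m L = 0 := by
  by_cases hk : k ∈ L
  · exact koszulContr_of_mem hk m
  · rw [koszulContr_of_notMem hk, hm, smul_zero]
    rw [Finset.card_insert_of_notMem hk]
    omega

/-- A value of a family, recovered from a contraction. -/
lemma eq_koszulSign_smul_koszulContr {k : Fin n} {J : Finset (Fin n)} (hk : k ∈ J)
    (m : Finset (Fin n) → M) :
    m J = koszulSign k (J.erase k) • koszulContr n k m (J.erase k) := by
  rw [koszulContr_of_notMem (Finset.notMem_erase k J), Finset.insert_erase hk, smul_smul,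
    koszulSign_mul_self, one_smul]

lemma eq_zero_of_koszulContr_eq_zero {i : ℕ} {m : Finset (Fin n) → M}
    (hm : ∀ J : Finset (Fin n), J.card ≠ i + 1 → m J = 0)
    (h : ∀ k, koszulContr n k m = 0) : m = 0 := by
  funext J
  rcases J.eq_empty_or_nonempty with rfl | ⟨k, hk⟩
  · exact hm _ (by simp)
  · rw [eq_koszulSign_smul_koszulContr hk m, h k]
    simp

variable [Module K M]

variable (K M) in
/-- The contraction as a linear map. -/
def koszulContrLinear (k : Fin n) :
    (Finset (Fin n) → M) →ₗ[K] (Finset (Fin n) → M) where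
  toFun := koszulContr n k
  map_add' a b := by
    funext L
    by_cases hk : k ∈ L
    · simp [koszulContr_of_mem hk]
    · simp [koszulContr_of_notMem hk]
  map_smul' c a := by
    funext L
    by_cases hk : k ∈ L
    · simp [koszulContr_of_mem hk]
    · simp [koszulContr_of_notMem hk, smul_comm c]

@[simp]
lemma koszulContrLinear_apply (k : Fin n) (m : Finset (Fin n) → M) :
    koszulContrLinear K M k m = koszulContr n k m := rfl

variable [Module (MvPolynomial (Fin n) K) M] [IsScalarTower K (MvPolynomial (Fin n) K) M]

lemma koszulD_apply_eq_sum (m : Finset (Fin n) → M) (L : Finset (Fin n)) :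
    koszulD n (K := K) m L =
      ∑ k, (X k : MvPolynomial (Fin n) K) • koszulContr n k m L := by
  rw [← Finset.sum_subset (Finset.subset_univ Lᶜ)]
  · refine Finset.sum_congr rfl fun k hk => ?_
    rw [koszulContr_of_notMem (Finset.mem_compl.1 hk)]
    exact (smul_comm _ _ _).symm
  · intro k _ hk
    rw [koszulContr_of_mem (by simpa using hk), smul_zero]

/-- The Koszul differential is natural in the coefficient module. -/
lemma koszulD_comp_apply {M' : Type*} [AddCommGroup M'] [Module K M']
    [Module (MvPolynomial (Fin n) K) M'] [IsScalarTower K (MvPolynomial (Fin n) K) M']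
    (f : M →ₗ[MvPolynomial (Fin n) K] M') (m : Finset (Fin n) → M) (L : Finset (Fin n)) :
    f (koszulD n (K := K) m L) = koszulD n (K := K) (fun J => f (m J)) L := by
  simp [koszulD]

lemma koszulD_koszulContr (k : Fin n) (m : Finset (Fin n) → M) :
    koszulD n (K := K) (koszulContr n k m) = -koszulContr n k (koszulD n (K := K) m) := by
  have hD : koszulD n (K := K) m =
      ∑ j, (X j : MvPolynomial (Fin n) K) • koszulContr n j m := by
    funext L
    simp [koszulD_apply_eq_sum]
  funext L
  rw [koszulD_apply_eq_sum, Pi.neg_apply]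
  simp_rw [koszulContr_anticomm _ k m, Pi.neg_apply, smul_neg]
  rw [Finset.sum_neg_distrib, neg_inj]
  by_cases hk : k ∈ L
  · simp [koszulContr_of_mem hk]
  · simp only [koszulContr_of_notMem hk, hD, Finset.sum_apply, Pi.smul_apply, Finset.smul_sum]
    exact Finset.sum_congr rfl fun j _ => smul_comm _ _ _

end KoszulContraction

section Vanishing

variable {K : Type*} [Field K] {n : ℕ}

/-- Over an infinite field, a Koszul cycle in homological degree `p` with values in a space of
polynomials of dimension at most `p` vanishes. -/
lemma koszul_cycle_eq_zero_of_infinite [Infinite K] (p : ℕ)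
    (W : Submodule K (MvPolynomial (Fin n) K)) [FiniteDimensional K W]
    (hW : Module.finrank K W ≤ p) (z : Finset (Fin n) → MvPolynomial (Fin n) K)
    (hzW : ∀ J, z J ∈ W) (hz : ∀ J : Finset (Fin n), J.card ≠ p → z J = 0)
    (hdz : koszulD n (K := K) z = 0) : z = 0 := by
  induction p generalizing W z with
  | zero =>
    have hbot : W = ⊥ := Submodule.finrank_eq_zero.1 (Nat.le_zero.1 hW)
    funext J
    simpa [hbot] using hzW J
  | succ p ih =>
    by_cases hbot : W = ⊥
    · funext J
      simpa [hbot] using hzW J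
    obtain ⟨f, hfW, hf⟩ := Submodule.exists_mem_ne_zero_of_ne_bot hbot
    have key : ∀ v : Fin n → K, eval v f ≠ 0 → ∑ k, v k • koszulContr n k z = 0 := by
      intro v hv
      let E : MvPolynomial (Fin n) K →ₗ[K] K := (aeval v).toLinearMap
      have hE : ∀ q, E q = eval v q := fun q => by simp [E, aeval_eq_eval]
      have hlt : W ⊓ LinearMap.ker E < W := by
        refine lt_of_le_of_ne inf_le_left fun h => hv ?_
        rw [← h] at hfW
        rw [← hE]
        exact hfW.2
      have hrank := Submodule.finrank_lt_finrank_of_lt hlt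
      have : FiniteDimensional K ↥(W ⊓ LinearMap.ker E) :=
        Submodule.finiteDimensional_of_le hlt.le
      refine ih (W ⊓ LinearMap.ker E) (by omega) _ (fun L => ⟨?_, ?_⟩) (fun L hL => ?_) ?_
      · rw [Finset.sum_apply]
        refine W.sum_mem fun k _ => W.smul_mem _ ?_
        by_cases hk : k ∈ L
        · simp [koszulContr_of_mem hk]
        · rw [koszulContr_of_notMem hk]
          exact zsmul_mem (hzW _) _
      · have h := congrArg (eval v) (congrFun hdz L)
        rw [koszulD_apply_eq_sum] at h
        change E _ = 0
        rw [hE]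
        simpa [smul_eval] using h
      · rw [Finset.sum_apply]
        refine Finset.sum_eq_zero fun k _ => ?_
        rw [Pi.smul_apply, koszulContr_eq_zero_of_card_ne hz k hL, smul_zero]
      · simp_rw [map_sum, map_smul, koszulD_koszulContr, hdz]
        refine Finset.sum_eq_zero fun k _ => ?_
        rw [← koszulContrLinear_apply (K := K), map_zero, neg_zero, smul_zero]
    refine eq_zero_of_koszulContr_eq_zero hz fun k => ?_
    funext L
    ext e
    let g : MvPolynomial (Fin n) K := ∑ j, C (coeff e (koszulContr n j z L)) * X j
    have hfg : f * g = 0 := by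
      refine MvPolynomial.funext fun v => ?_
      rw [map_mul, map_zero]
      by_cases hv : eval v f = 0
      · rw [hv, zero_mul]
      · have h := congrArg (coeff e) (congrFun (key v hv) L)
        rw [Finset.sum_apply, coeff_sum] at h
        have hg : eval v g = 0 := by
          rw [Pi.zero_apply, coeff_zero] at h
          rw [← h]
          simp [g, mul_comm]
        rw [hg, mul_zero]
    have hg : g = 0 := (mul_eq_zero.1 hfg).resolve_left hf
    have := congrArg (eval (Pi.single k 1)) hg
    simpa [g, Pi.single_apply] using this

/-- A Koszul cycle in homological degree `p` with values in a space of polynomials of dimension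
at most `p` vanishes. -/
lemma koszul_cycle_eq_zero (p : ℕ) (W : Submodule K (MvPolynomial (Fin n) K))
    [FiniteDimensional K W] (hW : Module.finrank K W ≤ p)
    (z : Finset (Fin n) → MvPolynomial (Fin n) K) (hzW : ∀ J, z J ∈ W)
    (hz : ∀ J : Finset (Fin n), J.card ≠ p → z J = 0)
    (hdz : koszulD n (K := K) z = 0) : z = 0 := by
  let A := AlgebraicClosure K
  let φ : MvPolynomial (Fin n) K →ₐ[K] MvPolynomial (Fin n) A := mapAlgHom (Algebra.ofId K A)
  have hφ : Function.Injective φ := map_injective _ (algebraMap K A).injective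
  have hφX : ∀ k, φ (X k) = X k := fun k => by simp [φ]
  let b := Module.finBasis K W
  let b' : Fin (Module.finrank K W) → MvPolynomial (Fin n) A := fun a => φ (b a)
  have hb' : Module.finrank A (Submodule.span A (Set.range b')) ≤ Module.finrank K W := by
    simpa [Set.finrank] using finrank_range_le_card (R := A) b'
  have : FiniteDimensional A (Submodule.span A (Set.range b')) :=
    FiniteDimensional.span_of_finite A (Set.finite_range b')
  have h0 : (fun J => φ (z J)) = 0 := by
    refine koszul_cycle_eq_zero_of_infinite (K := A) p (Submodule.span A (Set.range b'))
      (hb'.trans hW) _ (fun J => ?_) (fun J hJ => by rw [hz J hJ, map_zero]) ?_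
    · have h := congrArg (fun y : W => φ y) (b.sum_repr ⟨z J, hzW J⟩)
      simp only [AddSubmonoidClass.coe_finsetSum, Submodule.coe_smul, map_sum, map_smul] at h
      rw [← h]
      refine Submodule.sum_mem _ fun a _ => ?_
      rw [← algebraMap_smul A]
      exact Submodule.smul_mem _ _ (Submodule.subset_span ⟨a, rfl⟩)
    · funext L
      have h := congrArg φ (congrFun hdz L)
      rw [Pi.zero_apply, map_zero] at h
      rw [Pi.zero_apply, ← h]
      simp [koszulD, hφX]
  funext J
  exact hφ ((congrFun h0 J).trans (map_zero φ).symm)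

end Vanishing

section RankBound

variable {K : Type*} [Field K] {n r : ℕ}

/-- If the graded space `N` is stable under contractions, the values of its members all occur
as values at `∅` of members of `N 0`. -/
lemma apply_mem_map_proj_of_contr_stable {M : Type*} [AddCommGroup M] [Module K M]
    {N : ℕ → Submodule K (Finset (Fin n) → M)}
    (hsupp : ∀ i, ∀ m ∈ N i, ∀ J : Finset (Fin n), J.card ≠ i → m J = 0)
    (hcontr : ∀ i, ∀ m ∈ N (i + 1), ∀ k, koszulContr n k m ∈ N i)
    (p : ℕ) {z : Finset (Fin n) → M} (hz : z ∈ N p) (J : Finset (Fin n)) :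
    z J ∈ (N 0).map (LinearMap.proj (R := K) (φ := fun _ : Finset (Fin n) => M) ∅) := by
  induction p generalizing z J with
  | zero =>
    by_cases hJ : J = ∅
    · subst hJ
      exact ⟨z, hz, rfl⟩
    · rw [hsupp 0 z hz J (by simpa using hJ)]
      exact zero_mem _
  | succ p ih =>
    rcases J.eq_empty_or_nonempty with rfl | ⟨k, hk⟩
    · rw [hsupp _ z hz ∅ (by simp)]
      exact zero_mem _
    · rw [eq_koszulSign_smul_koszulContr hk z]
      exact zsmul_mem (ih (hcontr p z hz k) _) _

lemma succ_le_rank_zero_of_contr_stable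
    {N : ℕ → Submodule K (Finset (Fin n) → Fin r → MvPolynomial (Fin n) K)}
    (hsupp : ∀ i, ∀ m ∈ N i, ∀ J : Finset (Fin n), J.card ≠ i → m J = 0)
    (hcycle : ∀ i, ∀ m ∈ N i, koszulD n (K := K) m = 0)
    (hcontr : ∀ i, ∀ m ∈ N (i + 1), ∀ k, koszulContr n k m ∈ N i)
    (p : ℕ) (hp : N p ≠ ⊥) : ((p + 1 : ℕ) : Cardinal) ≤ Module.rank K (N 0) := by
  by_contra! hlt
  have hfin : FiniteDimensional K (N 0) :=
    Module.rank_lt_aleph0_iff.1 (hlt.trans (Cardinal.natCast_lt_aleph0))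
  have hle : Module.finrank K (N 0) ≤ p := by
    rw [← Module.finrank_eq_rank] at hlt
    exact Nat.lt_succ_iff.1 (by exact_mod_cast hlt)
  refine hp ((Submodule.eq_bot_iff _).2 fun z hz => ?_)
  funext J u
  let π : (Finset (Fin n) → Fin r → MvPolynomial (Fin n) K) →ₗ[K] MvPolynomial (Fin n) K :=
    LinearMap.proj (R := K) (φ := fun _ => MvPolynomial (Fin n) K) u ∘ₗ LinearMap.proj ∅
  have h0 : (fun J => z J u) = 0 := by
    refine koszul_cycle_eq_zero p ((N 0).map π) ((Submodule.finrank_map_le π (N 0)).trans hle) _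
      (fun J => ?_) (fun J hJ => by rw [hsupp p z hz J hJ, Pi.zero_apply]) ?_
    · obtain ⟨m, hm, hmz⟩ := apply_mem_map_proj_of_contr_stable hsupp hcontr p hz J
      exact ⟨m, hm, congrFun hmz u⟩
    · funext L
      refine (koszulD_comp_apply (LinearMap.proj (R := MvPolynomial (Fin n) K)
        (φ := fun _ : Fin r => MvPolynomial (Fin n) K) u) z L).symm.trans ?_
      rw [hcycle p z hz]
      rfl
  exact congrFun h0 J

/-- A graded space of Koszul cycles in a free module which is stable under contractions and
nonzero in degree `p` has dimension at least `(p + 1).choose (i + 1)` in degree `i`. -/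
lemma choose_le_rank_of_contr_stable (p : ℕ)
    (N : ℕ → Submodule K (Finset (Fin n) → Fin r → MvPolynomial (Fin n) K))
    (hsupp : ∀ i, ∀ m ∈ N i, ∀ J : Finset (Fin n), J.card ≠ i → m J = 0)
    (hcycle : ∀ i, ∀ m ∈ N i, koszulD n (K := K) m = 0)
    (hcontr : ∀ i, ∀ m ∈ N (i + 1), ∀ k, koszulContr n k m ∈ N i)
    (hp : N p ≠ ⊥) (i : ℕ) :
    ((p + 1).choose (i + 1) : Cardinal) ≤ Module.rank K (N i) := by
  induction p generalizing N i with
  | zero =>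
    cases i with
    | zero => simpa using succ_le_rank_zero_of_contr_stable hsupp hcycle hcontr 0 hp
    | succ i => simp [Nat.choose_eq_zero_of_lt]
  | succ p ih =>
    cases i with
    | zero => simpa using succ_le_rank_zero_of_contr_stable hsupp hcycle hcontr (p + 1) hp
    | succ i =>
      obtain ⟨z, hz, hz0⟩ := Submodule.exists_mem_ne_zero_of_ne_bot hp
      obtain ⟨k, hk⟩ : ∃ k, koszulContr n k z ≠ 0 := by
        by_contra! h
        exact hz0 (eq_zero_of_koszulContr_eq_zero (hsupp _ z hz) h)
      let δ := koszulContrLinear K (Fin r → MvPolynomial (Fin n) K) k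
      let N' : ℕ → Submodule K (Finset (Fin n) → Fin r → MvPolynomial (Fin n) K) :=
        fun i => (N (i + 1)).map δ
      have hN' : ∀ i, N' i ≤ N i := by
        rintro i _ ⟨m, hm, rfl⟩
        exact hcontr i m hm k
      have hbound := ih N' (fun i m hm => hsupp i m (hN' i hm))
        (fun i m hm => hcycle i m (hN' i hm))
        (by
          rintro i _ ⟨m, hm, rfl⟩ j
          rw [koszulContrLinear_apply, koszulContr_anticomm]
          exact neg_mem ⟨_, hcontr _ m hm j, rfl⟩)
        (fun h => hk ((Submodule.eq_bot_iff _).1 h _ ⟨z, hz, rfl⟩))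
      have hker : Module.rank K (N' (i + 1)) ≤
          Module.rank K (LinearMap.ker (δ.domRestrict (N (i + 1)))) := by
        refine LinearMap.rank_le_of_injective
          (LinearMap.codRestrict _ (Submodule.inclusion (hN' (i + 1))) ?_) ?_
        · rintro ⟨_, m, hm, rfl⟩
          exact koszulContr_koszulContr_self k m
        · intro a b hab
          exact Submodule.inclusion_injective (hN' (i + 1)) (congrArg Subtype.val hab)
      have hrange : LinearMap.range (δ.domRestrict (N (i + 1))) = N' i :=
        LinearMap.range_domRestrict _ _
      rw [← LinearMap.rank_range_add_rank_ker (δ.domRestrict (N (i + 1))), hrange,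
        Nat.choose_succ_succ, Nat.cast_add]
      exact add_le_add (hbound i) ((hbound (i + 1)).trans hker)

end RankBound

open MvPolynomial in
/-- Theorem 2.11 / Herzog's conjecture for `k = 1`: for a graded
submodule `M` of a graded free module `F` with initial degree `d` (a first syzygy
module), if `β_p^{lin}(M) ≠ 0` then `β_i^{lin}(M) = dim_K Z_i^d(n) ≥ C(p+1, i+1)`
for `i = 0, …, p`. -/
theorem syzygy_linear_strand_lower_bound {K : Type*} [Field K] {n : ℕ} (hn : 1 ≤ n)
    (r : ℕ) (w : Fin r → ℤ)
    (Mod : Submodule (MvPolynomial (Fin n) K) (Fin r → MvPolynomial (Fin n) K))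
    (hgraded : ∀ f ∈ Mod, f ∈ ⨆ l : ℤ,
      (Mod.restrictScalars K ⊓ gradedFreePiece n r K w l))
    (d : ℤ)
    (hneg : ∀ l : ℤ, l < d → Mod.restrictScalars K ⊓ gradedFreePiece n r K w l = ⊥)
    (hinit : Mod.restrictScalars K ⊓ gradedFreePiece n r K w d ≠ ⊥)
    (p : ℕ) (hpn : p ≤ n)
    (hnonzero :
      koszulZ n (fun l => Mod.restrictScalars K ⊓ gradedFreePiece n r K w l) p d n ≠ ⊥) :
    ∀ i : ℕ, i ≤ p → (Nat.choose (p + 1) (i + 1) : Cardinal) ≤ Module.rank K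
      (koszulZ n (fun l => Mod.restrictScalars K ⊓ gradedFreePiece n r K w l) i d n) := by
  intro i _
  refine choose_le_rank_of_contr_stable p
    (fun i => koszulZ n (fun l => Mod.restrictScalars K ⊓ gradedFreePiece n r K w l) i d n)
    (fun i m hm J hJ => (hm.1 J).2 fun h => hJ h.1) (fun i m hm => hm.2) ?_ hnonzero i
  rintro i m ⟨hm, hdm⟩ k
  have hdm' : koszulD n (K := K) m = 0 := hdm
  refine ⟨fun L => ⟨?_, fun hL => ?_⟩, ?_⟩
  · by_cases hk : k ∈ L
    · rw [koszulContr_of_mem hk]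
      exact zero_mem _
    · rw [koszulContr_of_notMem hk]
      exact zsmul_mem (hm _).1 _
  · exact koszulContr_eq_zero_of_card_ne (fun J hJ => (hm J).2 fun h => hJ h.1) k
      fun h => hL ⟨h, fun k _ => k.isLt⟩
  · change koszulD n (K := K) _ = 0
    rw [koszulD_koszulContr, hdm', ← koszulContrLinear_apply (K := K),
      map_zero, neg_zero]
end

section
/- Let p ∈ {0,…,j}, t ∈ ℕ and q ∈ {1,…,j}. Assume H_p^l(j) = 0 for all l with 0 ≤ l ≤ t−1. Let z ∈ C_p^t(j) be such that z_J = 0 for every p-subset J of {1,…,j} not contained in {1,…,j−q}, and suppose z = d(y) for some y ∈ C_{p+1}^{t−1}(j). Then there exists r ∈ C_{p+2}^{t−2}(j) such that ỹ := y + d(r) satisfies ỹ_J = 0 for every (p+1)-subset J of {1,…,j} not contained in {1,…,j−q}, and d(ỹ) = z. -/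
open MvPolynomial

namespace Koszul

open MvPolynomial

section Sign

variable {n : ℕ}

/-- The sign of moving the index `k` past the smaller elements of `L`. -/
def sgn (L : Finset (Fin n)) (k : Fin n) : ℤ := (-1) ^ (L.filter (fun l => l < k)).card

theorem sgn_mul_self (L : Finset (Fin n)) (k : Fin n) : sgn L k * sgn L k = 1 := by
  rw [sgn, ← mul_pow]; simp

theorem sgn_erase_self (L : Finset (Fin n)) (k : Fin n) : sgn (L.erase k) k = sgn L k := by
  rw [sgn, sgn, Finset.filter_erase, Finset.erase_eq_of_notMem (by simp)]

theorem sgn_insert_of_lt {L : Finset (Fin n)} {a b : Fin n} (ha : a ∉ L) (hab : a < b) :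
    sgn (insert a L) b = -sgn L b := by
  rw [sgn, sgn, Finset.filter_insert, if_pos hab, Finset.card_insert_of_notMem (by simp [ha]),
    pow_succ]
  ring

theorem sgn_insert_of_le {L : Finset (Fin n)} {a b : Fin n} (hab : b ≤ a) :
    sgn (insert a L) b = sgn L b := by
  rw [sgn, sgn, Finset.filter_insert, if_neg (not_lt.2 hab)]

theorem sgn_mul_sgn_insert {L : Finset (Fin n)} {a b : Fin n} (ha : a ∉ L) (hb : b ∉ L)
    (hab : a ≠ b) : sgn L a * sgn (insert a L) b = -(sgn L b * sgn (insert b L) a) := by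
  rcases lt_or_gt_of_ne hab with h | h
  · rw [sgn_insert_of_lt ha h, sgn_insert_of_le h.le]; ring
  · rw [sgn_insert_of_lt hb h, sgn_insert_of_le h.le]; ring

end Sign

section Operators

variable {n : ℕ} {M : Type*} [AddCommGroup M]

theorem contr_apply_of_mem {k : Fin n} {L : Finset (Fin n)} (h : k ∈ L)
    (m : Finset (Fin n) → M) : koszulContr n k m L = 0 := if_pos h

theorem contr_apply_of_notMem {k : Fin n} {L : Finset (Fin n)} (h : k ∉ L)
    (m : Finset (Fin n) → M) : koszulContr n k m L = sgn L k • m (insert k L) := if_neg h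

theorem contr_contr_self (k : Fin n) (m : Finset (Fin n) → M) :
    koszulContr n k (koszulContr n k m) = 0 := by
  funext L
  by_cases h : k ∈ L
  · simp [contr_apply_of_mem h]
  · simp [contr_apply_of_notMem h, contr_apply_of_mem (Finset.mem_insert_self k L)]

theorem contr_contr_comm (a b : Fin n) (m : Finset (Fin n) → M) :
    koszulContr n a (koszulContr n b m) = -koszulContr n b (koszulContr n a m) := by
  rcases eq_or_ne a b with rfl | hab
  · simp [contr_contr_self]
  funext L
  rw [Pi.neg_apply]
  by_cases ha : a ∈ L
  · by_cases hb : b ∈ L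
    · simp [contr_apply_of_mem ha, contr_apply_of_mem hb]
    · rw [contr_apply_of_mem ha, contr_apply_of_notMem hb,
        contr_apply_of_mem (Finset.mem_insert_of_mem ha), smul_zero, neg_zero]
  · by_cases hb : b ∈ L
    · rw [contr_apply_of_mem hb, contr_apply_of_notMem ha,
        contr_apply_of_mem (Finset.mem_insert_of_mem hb), smul_zero, neg_zero]
    · rw [contr_apply_of_notMem ha, contr_apply_of_notMem hb,
        contr_apply_of_notMem (by simp [hb, hab.symm]), contr_apply_of_notMem (by simp [ha, hab]),
        Finset.insert_comm, smul_smul, smul_smul, sgn_mul_sgn_insert ha hb hab, neg_smul]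

theorem contr_smul {R : Type*} [Ring R] [Module R M] (k : Fin n) (c : R)
    (m : Finset (Fin n) → M) : koszulContr n k (c • m) = c • koszulContr n k m := by
  funext L
  by_cases h : k ∈ L
  · simp [contr_apply_of_mem h]
  · simp [contr_apply_of_notMem h, smul_comm c]

theorem contr_add (k : Fin n) (m m' : Finset (Fin n) → M) :
    koszulContr n k (m + m') = koszulContr n k m + koszulContr n k m' := by
  funext L
  by_cases h : k ∈ L
  · simp [contr_apply_of_mem h]
  · simp [contr_apply_of_notMem h]

theorem contr_sum {ι : Type*} (k : Fin n) (s : Finset ι) (f : ι → Finset (Fin n) → M) :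
    koszulContr n k (∑ i ∈ s, f i) = ∑ i ∈ s, koszulContr n k (f i) :=
  map_sum (AddMonoidHom.mk' (koszulContr n (M := M) k) (contr_add k)) f s

/-- Exterior multiplication by the basis vector indexed by `k`. -/
def wedge (k : Fin n) (m : Finset (Fin n) → M) : Finset (Fin n) → M :=
  fun L => if k ∈ L then sgn L k • m (L.erase k) else 0

theorem wedge_apply_of_mem {k : Fin n} {L : Finset (Fin n)} (h : k ∈ L)
    (m : Finset (Fin n) → M) : wedge k m L = sgn L k • m (L.erase k) := if_pos h

theorem wedge_apply_of_notMem {k : Fin n} {L : Finset (Fin n)} (h : k ∉ L)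
    (m : Finset (Fin n) → M) : wedge k m L = 0 := if_neg h

theorem wedge_smul {R : Type*} [Ring R] [Module R M] (k : Fin n) (c : R)
    (m : Finset (Fin n) → M) : wedge k (c • m) = c • wedge k m := by
  funext L
  by_cases h : k ∈ L
  · simp [wedge_apply_of_mem h, smul_comm c]
  · simp [wedge_apply_of_notMem h]

theorem wedge_add (k : Fin n) (m m' : Finset (Fin n) → M) :
    wedge k (m + m') = wedge k m + wedge k m' := by
  funext L
  by_cases h : k ∈ L
  · simp [wedge_apply_of_mem h]
  · simp [wedge_apply_of_notMem h]

theorem wedge_sum {ι : Type*} (k : Fin n) (s : Finset ι) (f : ι → Finset (Fin n) → M) :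
    wedge k (∑ i ∈ s, f i) = ∑ i ∈ s, wedge k (f i) :=
  map_sum (AddMonoidHom.mk' (wedge (M := M) k) (wedge_add k)) f s

theorem contr_wedge_self_add (k : Fin n) (m : Finset (Fin n) → M) :
    koszulContr n k (wedge k m) + wedge k (koszulContr n k m) = m := by
  funext L
  rw [Pi.add_apply]
  by_cases h : k ∈ L
  · rw [contr_apply_of_mem h, wedge_apply_of_mem h, contr_apply_of_notMem (by simp),
      Finset.insert_erase h, smul_smul, sgn_erase_self, sgn_mul_self, one_smul, zero_add]
  · rw [contr_apply_of_notMem h, wedge_apply_of_notMem h,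
      wedge_apply_of_mem (Finset.mem_insert_self k L), Finset.erase_insert h, smul_smul,
      sgn_insert_of_le le_rfl, sgn_mul_self, one_smul, add_zero]

theorem contr_wedge_of_ne {a k : Fin n} (h : a ≠ k) (m : Finset (Fin n) → M) :
    koszulContr n a (wedge k m) = -wedge k (koszulContr n a m) := by
  funext L
  rw [Pi.neg_apply]
  by_cases ha : a ∈ L
  · rw [contr_apply_of_mem ha]
    by_cases hk : k ∈ L
    · rw [wedge_apply_of_mem hk, contr_apply_of_mem (by simp [ha, h]), smul_zero, neg_zero]
    · rw [wedge_apply_of_notMem hk, neg_zero]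
  · rw [contr_apply_of_notMem ha]
    by_cases hk : k ∈ L
    · obtain ⟨L, hk', rfl⟩ : ∃ L', k ∉ L' ∧ insert k L' = L :=
        ⟨L.erase k, by simp, Finset.insert_erase hk⟩
      have haL : a ∉ L := fun h' => ha (Finset.mem_insert_of_mem h')
      rw [wedge_apply_of_mem (by simp), wedge_apply_of_mem hk, Finset.insert_comm,
        Finset.erase_insert (by simp [hk', h.symm]), Finset.erase_insert hk',
        contr_apply_of_notMem haL, smul_smul, smul_smul, sgn_insert_of_le le_rfl,
        sgn_insert_of_le le_rfl, ← neg_smul]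
      congr 1
      rcases lt_or_gt_of_ne h with h' | h'
      · rw [sgn_insert_of_lt haL h', sgn_insert_of_le h'.le]; ring
      · rw [sgn_insert_of_lt hk' h', sgn_insert_of_le h'.le]; ring
    · rw [wedge_apply_of_notMem (by simp [hk, h.symm]), wedge_apply_of_notMem hk, smul_zero,
        neg_zero]

end Operators

section Differential

variable {n : ℕ} {K : Type*} [Field K] {M : Type*} [AddCommGroup M] [Module K M]
  [Module (MvPolynomial (Fin n) K) M] [IsScalarTower K (MvPolynomial (Fin n) K) M]

theorem koszulD_eq_sum (m : Finset (Fin n) → M) :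
    koszulD n (K := K) m = ∑ k, (X k : MvPolynomial (Fin n) K) • koszulContr n k m := by
  funext L
  rw [Finset.sum_apply]
  change ∑ k ∈ Lᶜ, sgn L k • ((X k : MvPolynomial (Fin n) K) • m (insert k L)) = _
  rw [← Finset.sum_subset (Finset.subset_univ Lᶜ)]
  · refine Finset.sum_congr rfl fun k hk => ?_
    rw [Pi.smul_apply, contr_apply_of_notMem (Finset.mem_compl.1 hk), smul_comm]
  · intro k _ hk
    rw [Pi.smul_apply, contr_apply_of_mem (by simpa using hk), smul_zero]

theorem koszulD_contr (k : Fin n) (m : Finset (Fin n) → M) :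
    koszulD n (K := K) (koszulContr n k m) = -koszulContr n k (koszulD n (K := K) m) := by
  simp only [koszulD_eq_sum, contr_sum, contr_smul, ← Finset.sum_neg_distrib, ← smul_neg]
  exact Finset.sum_congr rfl fun a _ => by rw [contr_contr_comm]

theorem koszulD_koszulD (m : Finset (Fin n) → M) :
    koszulD n (K := K) (koszulD n (K := K) m) = 0 := by
  simp only [koszulD_eq_sum, contr_sum, contr_smul, Finset.smul_sum]
  rw [← Finset.sum_product']
  refine Finset.sum_involution (fun a _ => a.swap) ?_ ?_ (by simp) (by simp)
  · rintro ⟨a, b⟩ -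
    rw [Prod.swap, contr_contr_comm, smul_neg, smul_neg, smul_comm, neg_add_cancel]
  · rintro ⟨a, b⟩ - hne heq
    obtain rfl : b = a := congrArg Prod.fst heq
    simp [contr_contr_self] at hne

theorem koszulD_wedge (k : Fin n) (m : Finset (Fin n) → M) :
    koszulD n (K := K) (wedge k m) =
      (X k : MvPolynomial (Fin n) K) • m - wedge k (koszulD n (K := K) m) := by
  rw [eq_sub_iff_add_eq]
  simp only [koszulD_eq_sum, wedge_sum, wedge_smul]
  rw [← Finset.sum_add_distrib, Finset.sum_eq_single k]
  · rw [← smul_add, contr_wedge_self_add]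
  · intro a _ h
    rw [contr_wedge_of_ne h, smul_neg, neg_add_cancel]
  · simp

end Differential

section Graded

variable {n : ℕ} {K : Type*} [Field K] {M : Type*} [AddCommGroup M] [Module K M]
  {gr : ℤ → Submodule K M}

theorem koszulC_mono {i : ℕ} {t : ℤ} {j j' : ℕ} (h : j ≤ j') :
    koszulC n gr i t j ≤ koszulC n gr i t j' := fun _ hm J =>
  ⟨(hm J).1, fun hJ => (hm J).2 fun h' => hJ ⟨h'.1, fun k hk => (h'.2 k hk).trans_le h⟩⟩

theorem eq_zero_of_mem_koszulC {i : ℕ} {t : ℤ} {j : ℕ} (ht : gr t = ⊥)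
    {m : Finset (Fin n) → M} (hm : m ∈ koszulC n gr i t j) : m = 0 :=
  funext fun J => by simpa [ht] using (hm J).1

theorem mem_koszulC_of_contr_eq_zero {i : ℕ} {t : ℤ} {k : Fin n}
    {m : Finset (Fin n) → M} (hm : m ∈ koszulC n gr i t (k + 1))
    (h : koszulContr n k m = 0) : m ∈ koszulC n gr i t k := by
  refine fun J => ⟨(hm J).1, fun hJ => ?_⟩
  by_cases hk : k ∈ J
  · have h1 := congrFun h (J.erase k)
    rw [contr_apply_of_notMem (by simp), Finset.insert_erase hk] at h1
    have h2 := congrArg (sgn (J.erase k) k • ·) h1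
    simpa [smul_smul, sgn_mul_self] using h2
  · refine (hm J).2 fun h' => hJ ⟨h'.1, fun l hl => ?_⟩
    have := h'.2 l hl
    have hne : (l : ℕ) ≠ k := fun e => hk (Fin.ext e ▸ hl)
    omega

theorem contr_mem_koszulC {i : ℕ} {t : ℤ} {k : Fin n} {m : Finset (Fin n) → M}
    (hm : m ∈ koszulC n gr (i + 1) t (k + 1)) : koszulContr n k m ∈ koszulC n gr i t k := by
  refine fun J => ?_
  by_cases hk : k ∈ J
  · simp [contr_apply_of_mem hk]
  · rw [contr_apply_of_notMem hk]
    refine ⟨zsmul_mem (hm _).1 _, fun hJ => ?_⟩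
    rw [(hm _).2, smul_zero]
    rw [Finset.card_insert_of_notMem hk]
    rintro ⟨h1, h2⟩
    refine hJ ⟨by omega, fun l hl => ?_⟩
    have := h2 l (Finset.mem_insert_of_mem hl)
    have hne : (l : ℕ) ≠ k := fun e => hk (Fin.ext e ▸ hl)
    omega

theorem wedge_mem_koszulC {i : ℕ} {t : ℤ} {k : Fin n} {m : Finset (Fin n) → M}
    (hm : m ∈ koszulC n gr i t k) : wedge k m ∈ koszulC n gr (i + 1) t (k + 1) := by
  refine fun J => ?_
  by_cases hk : k ∈ J
  · rw [wedge_apply_of_mem hk]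
    refine ⟨zsmul_mem (hm _).1 _, fun hJ => ?_⟩
    rw [(hm _).2, smul_zero]
    rintro ⟨h1, h2⟩
    refine hJ ⟨by rw [← h1, Finset.card_erase_add_one hk], fun l hl => ?_⟩
    rcases eq_or_ne l k with rfl | hne
    · omega
    · have := h2 l (Finset.mem_erase.2 ⟨hne, hl⟩)
      omega
  · simp [wedge_apply_of_notMem hk]

theorem contr_eq_zero_of_mem_koszulC {i : ℕ} {t : ℤ} {k : Fin n} {m : Finset (Fin n) → M}
    (hm : m ∈ koszulC n gr i t k) : koszulContr n k m = 0 := by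
  funext J
  by_cases hk : k ∈ J
  · rw [contr_apply_of_mem hk, Pi.zero_apply]
  · rw [contr_apply_of_notMem hk, (hm _).2, smul_zero, Pi.zero_apply]
    exact fun h => lt_irrefl _ (h.2 k (Finset.mem_insert_self _ _))

variable [Module (MvPolynomial (Fin n) K) M]

theorem X_smul_mem_koszulC
    (hcompat : ∀ (i : Fin n) (l : ℤ), ∀ m ∈ gr l,
      (X i : MvPolynomial (Fin n) K) • m ∈ gr (l + 1))
    {i : ℕ} {t : ℤ} {j : ℕ} (k : Fin n) {m : Finset (Fin n) → M}
    (hm : m ∈ koszulC n gr i t j) :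
    (X k : MvPolynomial (Fin n) K) • m ∈ koszulC n gr i (t + 1) j := fun J =>
  ⟨hcompat k t _ (hm J).1, fun hJ => by rw [Pi.smul_apply, (hm J).2 hJ, smul_zero]⟩

variable [IsScalarTower K (MvPolynomial (Fin n) K) M]

/-- If cycles in `C_p^t(k)` are boundaries in degree `t`, a chain whose boundary does not involve
the last variable can be corrected by a boundary so as not to involve it either. -/
theorem exists_add_koszulD_mem_koszulC
    (hcompat : ∀ (i : Fin n) (l : ℤ), ∀ m ∈ gr l,
      (X i : MvPolynomial (Fin n) K) • m ∈ gr (l + 1))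
    {p : ℕ} {t : ℤ} {k : Fin n} (hH : koszulZ n gr p t k ≤ koszulB n gr p t k)
    {y : Finset (Fin n) → M} (hy : y ∈ koszulC n gr (p + 1) t (k + 1))
    (hdy : koszulContr n k (koszulD n (K := K) y) = 0) :
    ∃ r ∈ koszulC n gr (p + 2) (t - 1) (k + 1),
      y + koszulD n (K := K) r ∈ koszulC n gr (p + 1) t k := by
  obtain ⟨c, hc, hdc⟩ := hH (show koszulContr n k y ∈ koszulZ n gr p t k from
    ⟨contr_mem_koszulC hy, LinearMap.mem_ker.2 (by rw [koszulD_contr, hdy, neg_zero])⟩)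
  refine ⟨wedge k c, wedge_mem_koszulC hc, ?_⟩
  have hXc := X_smul_mem_koszulC hcompat k hc
  rw [sub_add_cancel] at hXc
  have hsplit : y + koszulD n (K := K) (wedge k c) =
      koszulContr n k (wedge k y) + (X k : MvPolynomial (Fin n) K) • c := by
    rw [koszulD_wedge, hdc]
    nth_rewrite 1 [← contr_wedge_self_add k y]
    abel
  have hmem : y + koszulD n (K := K) (wedge k c) ∈ koszulC n gr (p + 1) t (k + 1) := by
    rw [koszulD_wedge, hdc]
    exact add_mem hy (sub_mem (koszulC_mono (Nat.le_succ _) hXc)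
      (wedge_mem_koszulC (contr_mem_koszulC hy)))
  refine mem_koszulC_of_contr_eq_zero hmem ?_
  rw [hsplit, contr_add, contr_contr_self, contr_eq_zero_of_mem_koszulC hXc, add_zero]

/-- Vanishing of `H_p` in all degrees below `t` passes from `k + 1` variables to `k`. -/
theorem koszulZ_le_koszulB_of_succ
    (hcompat : ∀ (i : Fin n) (l : ℤ), ∀ m ∈ gr l,
      (X i : MvPolynomial (Fin n) K) • m ∈ gr (l + 1))
    (hneg : ∀ l : ℤ, l < 0 → gr l = ⊥) {p t : ℕ} {k : Fin n}
    (hH : ∀ l : ℤ, l < t → koszulZ n gr p l (k + 1) ≤ koszulB n gr p l (k + 1)) :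
    ∀ l : ℤ, l < t → koszulZ n gr p l k ≤ koszulB n gr p l k := by
  induction t with
  | zero =>
    intro l hl m hm
    rw [eq_zero_of_mem_koszulC (hneg l (by simpa using hl)) hm.1]
    exact zero_mem _
  | succ t ih =>
    intro l hl b hb
    have ih' := ih fun l hl => hH l (by push_cast; omega)
    obtain ⟨y, hy, rfl⟩ := hH l hl ⟨koszulC_mono (Nat.le_succ _) hb.1, hb.2⟩
    obtain ⟨r, -, hr⟩ := exists_add_koszulD_mem_koszulC hcompat
      (ih' (l - 1) (by push_cast at hl; omega)) hy (contr_eq_zero_of_mem_koszulC hb.1)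
    exact ⟨_, hr, by rw [map_add, koszulD_koszulD, add_zero]⟩

/-- The correction of a preimage, removing the last `q` variables one at a time. -/
theorem exists_add_koszulD_mem_koszulC_of_le
    (hcompat : ∀ (i : Fin n) (l : ℤ), ∀ m ∈ gr l,
      (X i : MvPolynomial (Fin n) K) • m ∈ gr (l + 1))
    (hneg : ∀ l : ℤ, l < 0 → gr l = ⊥) {p t i : ℕ} (q : ℕ) (hn : i + q ≤ n)
    (hH : ∀ l : ℤ, l < t → koszulZ n gr p l (i + q) ≤ koszulB n gr p l (i + q))
    {y : Finset (Fin n) → M} (hy : y ∈ koszulC n gr (p + 1) (t - 1 : ℤ) (i + q))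
    (hdy : koszulD n (K := K) y ∈ koszulC n gr p (t : ℤ) i) :
    ∃ r ∈ koszulC n gr (p + 2) (t - 2 : ℤ) (i + q),
      y + koszulD n (K := K) r ∈ koszulC n gr (p + 1) (t - 1 : ℤ) i := by
  induction q generalizing y with
  | zero => exact ⟨0, zero_mem _, by simpa using hy⟩
  | succ q ih =>
    have hH' := koszulZ_le_koszulB_of_succ (k := ⟨i + q, hn⟩) hcompat hneg hH
    obtain ⟨r, hr, hyr⟩ := exists_add_koszulD_mem_koszulC (k := ⟨i + q, hn⟩) hcompat
      (hH' (t - 1) (by omega)) hy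
      (contr_eq_zero_of_mem_koszulC (koszulC_mono (Nat.le_add_right i q) hdy))
    obtain ⟨r', hr', hyr'⟩ := ih (by omega) hH' hyr (by rwa [map_add, koszulD_koszulD, add_zero])
    rw [sub_sub] at hr
    refine ⟨r + r', add_mem hr (koszulC_mono (Nat.le_succ _) hr'), ?_⟩
    rwa [map_add, ← add_assoc]

end Graded

end Koszul

open MvPolynomial in
/-- Lemma 2.3: if `H_p^l(j) = 0` for `l < t`, `z ∈ C_p^t(j)` is
supported on subsets of `{1, …, j-q}` and `z = d(y)`, then `y` can be corrected by a
boundary to a preimage `ỹ` of `z` supported on subsets of `{1, …, j-q}`. -/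
theorem koszul_preimage_supported {K : Type*} [Field K] {n : ℕ}
    {M : Type*} [AddCommGroup M] [Module K M]
    [Module (MvPolynomial (Fin n) K) M] [IsScalarTower K (MvPolynomial (Fin n) K) M]
    (gr : ℤ → Submodule K M)
    (hdecomp : DirectSum.IsInternal gr)
    (hcompat : ∀ (i : Fin n) (l : ℤ), ∀ m ∈ gr l,
      (X i : MvPolynomial (Fin n) K) • m ∈ gr (l + 1))
    (hneg : ∀ l : ℤ, l < 0 → gr l = ⊥)
    (p : ℕ) (t : ℕ) (q : ℕ) (j : ℕ) (hpj : p ≤ j) (hq1 : 1 ≤ q) (hqj : q ≤ j) (hjn : j ≤ n)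
    (hvanish : ∀ l : ℕ, l < t →
      koszulZ n gr p (l : ℤ) j ≤ koszulB n gr p (l : ℤ) j)
    (z : Finset (Fin n) → M) (hz : z ∈ koszulC n gr p (t : ℤ) j)
    (hsupp : ∀ J : Finset (Fin n), ¬(∀ k ∈ J, (k : ℕ) < j - q) → z J = 0)
    (y : Finset (Fin n) → M) (hy : y ∈ koszulC n gr (p + 1) ((t : ℤ) - 1) j)
    (hzy : koszulD n (K := K) y = z) :
    ∃ r ∈ koszulC n gr (p + 2) ((t : ℤ) - 2) j,
      (∀ J : Finset (Fin n), ¬(∀ k ∈ J, (k : ℕ) < j - q) →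
        (y + koszulD n (K := K) r) J = 0) ∧
      koszulD n (K := K) (y + koszulD n (K := K) r) = z := by
  obtain ⟨i, rfl⟩ : ∃ i, j = i + q := ⟨j - q, by omega⟩
  rw [Nat.add_sub_cancel] at *
  subst hzy
  have hH : ∀ l : ℤ, l < t → koszulZ n gr p l (i + q) ≤ koszulB n gr p l (i + q) := by
    intro l hl
    rcases lt_or_ge l 0 with h | h
    · intro m hm
      rw [Koszul.eq_zero_of_mem_koszulC (hneg l h) hm.1]
      exact zero_mem _
    · lift l to ℕ using h
      exact hvanish l (by exact_mod_cast hl)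
  have hdy : koszulD n (K := K) y ∈ koszulC n gr p (t : ℤ) i := by
    refine fun J => ⟨(hz J).1, fun hJ => ?_⟩
    by_cases h : ∀ k ∈ J, (k : ℕ) < i
    · exact (hz J).2 fun h' => hJ ⟨h'.1, h⟩
    · exact hsupp J h
  obtain ⟨r, hr, hyr⟩ :=
    Koszul.exists_add_koszulD_mem_koszulC_of_le hcompat hneg q hjn hH hy hdy
  exact ⟨r, hr, fun J hJ => (hyr J).2 fun h => hJ h.2,
    by rw [map_add, Koszul.koszulD_koszulD, add_zero]⟩
end
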